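/- Let F be a field of characteristic ≠ 2, ζ₁,...,ζ₆ ∈ F pairwise distinct, and for each of the six 4-simplices u of the 3→3 Pachner move let ε_u ∈ {±1} be: ε₁₂₃₄₅ = 1, ε₁₂₃₄₆ = −1, ε₁₂₃₅₆ = 1, ε₁₂₄₅₆ = 1, ε₁₃₄₅₆ = −1, ε₂₃₄₅₆ = 1. Given coefficients c_{t,m} ∈ F for every boundary tetrahedron t of the move and its 'opposite vertex' m (so that t ∪ {m} is a 4-simplex of the corresponding side), define the x-chain x_{u,p} by the boundary-g₃ construction and set W̃_u = W_u + ε_u Σ_{p ∈ u} x_{u,p} v_{u,p}. If the x-chains on the left side (4-simplices 12345, 12346, 12356) and on the right side (12456, 13456, 23456) come from the same boundary tetrahedron chain, then the deformed 3→3 relation holds: the Berezin integral of W̃₁₂₃₄₅ W̃₁₂₃₄₆ W̃₁₂₃₅₆ w₁₂₃ over (a,b) of the inner tetrahedra 1234, 1235, 1236 with measures da db/ζ₃₄, da db/ζ₃₅, da db/ζ₃₆ equals the Berezin integral of W̃₁₂₄₅₆ W̃₁₃₄₅₆ W̃₂₃₄₅₆ w₄₅₆ over the inner tetrahedra 1456,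 2456, 3456 with measures da db/ζ₅₆ each. -/

import Mathlib

noncomputable section

variable (F : Type*) [Field F]

/-- Exterior (Grassmann) algebra on generators `a_t, b_t` indexed by tetrahedra
`t ⊂ {1,…,6}` (0-indexed as `Fin 6`). -/
abbrev Lam := ExteriorAlgebra F ((Bool × Finset (Fin 6)) → F)

/-- generator `a_t` -/
def av (t : Finset (Fin 6)) : Lam F := ExteriorAlgebra.ι F (Pi.single (false, t) 1)
/-- generator `b_t` -/
def bv (t : Finset (Fin 6)) : Lam F := ExteriorAlgebra.ι F (Pi.single (true, t) 1)

/-- The odd derivation `∂/∂a_t`. -/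
def da (t : Finset (Fin 6)) : Lam F →ₗ[F] Lam F :=
  CliffordAlgebra.contractLeft (LinearMap.proj (false, t))
/-- The odd derivation `∂/∂b_t`. -/
def db (t : Finset (Fin 6)) : Lam F →ₗ[F] Lam F :=
  CliffordAlgebra.contractLeft (LinearMap.proj (true, t))

/-- Berezin integral `∫ f da_t db_t`. -/
def int2 (t : Finset (Fin 6)) (f : Lam F) : Lam F := db F t (da F t f)

variable (ζ : Fin 6 → F)

/-- The degree-1 elements `v_{u,1},…,v_{u,5}` of the 4-simplex `u = ijklm` (`i<j<k<l<m`):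
the first three by the explicit formulas of the paper, the last two as the unique solutions
of `Σ_p v_{u,p} = 0`, `Σ_p ζ_p v_{u,p} = 0`. -/
def vv (i j k l m : Fin 6) : Fin 5 → Lam F :=
  let v1 : Lam F :=
    (ζ k - ζ l) • av F {i,j,k,l} - (ζ k - ζ m) • av F {i,j,k,m}
      + (ζ l - ζ m) • av F {i,j,l,m} - (ζ l - ζ m) • av F {i,k,l,m}
  let v2 : Lam F :=
    (ζ k - ζ l) • bv F {i,j,k,l} - (ζ k - ζ m) • bv F {i,j,k,m}
      + (ζ l - ζ m) • bv F {i,j,l,m} + (ζ l - ζ m) • av F {j,k,l,m}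
  let v3 : Lam F :=
    -((ζ i - ζ l) • av F {i,j,k,l}) - (ζ j - ζ l) • bv F {i,j,k,l}
      + (ζ i - ζ m) • av F {i,j,k,m} + (ζ j - ζ m) • bv F {i,j,k,m}
      - (ζ l - ζ m) • bv F {i,k,l,m} + (ζ l - ζ m) • bv F {j,k,l,m}
  ![v1, v2, v3,
    (ζ m - ζ l)⁻¹ • ((ζ i - ζ m) • v1 + (ζ j - ζ m) • v2 + (ζ k - ζ m) • v3),
    (ζ l - ζ m)⁻¹ • ((ζ i - ζ l) • v1 + (ζ j - ζ l) • v2 + (ζ k - ζ l) • v3)]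

/-- The deformed Grassmann weight `W̃_u = W_u + ε_u Σ_p x_{u,p} v_{u,p}`,
where `W_u = (1/ζ_{lm}) v_{u,1} v_{u,2} v_{u,3}`. -/
def Wt (eps : ℤ) (i j k l m : Fin 6) (x : Fin 5 → F) : Lam F :=
  (ζ l - ζ m)⁻¹ • (vv F ζ i j k l m 0 * vv F ζ i j k l m 1 * vv F ζ i j k l m 2)
    + (eps : F) • ∑ p : Fin 5, x p • vv F ζ i j k l m p

/-- The x-chain on the 4-simplex `ijklm` obtained from a boundary tetrahedron chain `c`
by the boundary-`g₃` construction: `x_{u,p} = c(u \ {p-th vertex})` if that face is a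
boundary tetrahedron (not in the set `inner` of inner tetrahedra), else `0`. -/
def xch (c : Finset (Fin 6) → F) (inner : Finset (Finset (Fin 6)))
    (i j k l m : Fin 6) : Fin 5 → F := fun p =>
  let t := ({i,j,k,l,m} : Finset (Fin 6)).erase (![i,j,k,l,m] p)
  if t ∈ inner then 0 else c t

set_option linter.unusedSimpArgs false
set_option linter.unusedVariables false

set_option maxHeartbeats 4000000 in
theorem core33 {F R : Type*} [Field F] [Ring R] [Algebra F R] (g : Fin 10 → R)
    (sq : ∀ i, g i * g i = 0) (sw : ∀ i j, g i * g j = -(g j * g i))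
    (I1 I2 I3 : R →ₗ[F] R) (D1 D2 D3 : F)
    (h1 : ∀ i z, i < 8 → I1 (g i * z) = g i * I1 z)
    (h1' : ∀ i, I1 (g i) = 0) (h1D : I1 (g 8 * g 9) = D1 • 1)
    (h2 : ∀ i z, i < 6 → I2 (g i * z) = g i * I2 z)
    (h2' : ∀ i, I2 (g i) = 0) (h20 : I2 1 = 0) (h2D : I2 (g 6 * g 7) = D2 • 1)
    (h3 : ∀ i z, i < 4 → I3 (g i * z) = g i * I3 z)
    (h3' : ∀ i, I3 (g i) = 0) (h30 : I3 1 = 0) (h3D : I3 (g 4 * g 5) = D3 • 1)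
    (k1 k2 k3 y11 y12 y13 y21 y22 y23 y31 y32 y33 : F) :
    I3 (I2 (I1 ((k3 • (-g 8 * g 6 * (g 7 - g 9))
          + (y31 • (-g 8) + y32 • g 6 + y33 • (g 7 - g 9)))
      * (k2 • ((g 0 - g 8) * g 4 * (g 5 - g 9))
          + (y21 • (g 0 - g 8) + y22 • g 4 + y23 • (g 5 - g 9)))
      * (k1 • ((g 1 - g 6) * (g 2 + g 4) * (g 5 - g 7 + g 3))
          + (y11 • (g 1 - g 6) + y12 • (g 2 + g 4) + y13 • (g 5 - g 7 + g 3)))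
      * g 9)))
    = (D1 * D2 * D3) • (
        (-(y13*y22*k3) + y12*y23*k3 - y23*y31*k1 - y13*y32*k2 + y11*y33*k2 + y21*y33*k1) • (1 : R)
        - (y11*k2*k3 + y21*k1*k3) • (g 0 * g 1)
        + (y31*k1*k2 - y12*k2*k3) • (g 0 * g 2)
        - (y22*k1*k3 + y32*k1*k2) • (g 1 * g 2)
        - (y13*k2*k3) • (g 0 * g 3)
        - (y23*k1*k3) • (g 1 * g 3)
        + (y33*k1*k2) • (g 2 * g 3)
        - (k1*k2*k3) • (g 0 * (g 1 * (g 2 * g 3)))) := by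
  have s1 : ∀ i j, j < i → g i * g j = -(g j * g i) := fun i j _ => sw i j
  have s2 : ∀ i j z, j < i → g i * (g j * z) = -(g j * (g i * z)) := fun i j z _ => by
    rw [← mul_assoc, sw i j, neg_mul, mul_assoc]
  have sq2 : ∀ i z, g i * (g i * z) = 0 := fun i z => by rw [← mul_assoc, sq, zero_mul]
  clear sw
  simp only [add_mul, mul_add, sub_mul, mul_sub, mul_assoc, smul_mul_assoc, mul_smul_comm,
    neg_mul, mul_neg, smul_neg, neg_neg, smul_add, smul_sub]
  simp (discharger := decide) only [s1, s2, sq, sq2, mul_neg, neg_neg, mul_zero, smul_zero, neg_zero, smul_neg,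
    sub_zero, zero_sub, add_zero, zero_add]
  simp (discharger := decide) only [map_add, map_sub, map_neg, map_smul, h1, h1', h1D, map_zero,
    mul_zero, smul_zero, mul_smul_comm, mul_one, neg_zero, sub_zero, zero_sub, add_zero, zero_add]
  simp (discharger := decide) only [map_add, map_sub, map_neg, map_smul, h2, h2', h2D, h20, map_zero,
    mul_zero, smul_zero, mul_smul_comm, mul_one, neg_zero, sub_zero, zero_sub, add_zero, zero_add]
  simp (discharger := decide) only [map_add, map_sub, map_neg, map_smul, h3, h3', h3D, h30, map_zero,
    mul_zero, smul_zero, mul_smul_comm, mul_one, neg_zero, sub_zero, zero_sub, add_zero, zero_add]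
  module

theorem iota_anti (x y : (Bool × Finset (Fin 6)) → F) :
    ExteriorAlgebra.ι F x * ExteriorAlgebra.ι F y
      = -(ExteriorAlgebra.ι F y * ExteriorAlgebra.ι F x) :=
  eq_neg_of_add_eq_zero_left (ExteriorAlgebra.ι_add_mul_swap x y)

/-- `int2` as a linear map -/
def int2L (t : Finset (Fin 6)) : Lam F →ₗ[F] Lam F := db F t ∘ₗ da F t

theorem da_mul (t : Finset (Fin 6)) (x : (Bool × Finset (Fin 6)) → F) (z : Lam F) :
    da F t (ExteriorAlgebra.ι F x * z)
      = x (false, t) • z - ExteriorAlgebra.ι F x * da F t z :=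
  CliffordAlgebra.contractLeft_ι_mul _ _ _

theorem db_mul (t : Finset (Fin 6)) (x : (Bool × Finset (Fin 6)) → F) (z : Lam F) :
    db F t (ExteriorAlgebra.ι F x * z)
      = x (true, t) • z - ExteriorAlgebra.ι F x * db F t z :=
  CliffordAlgebra.contractLeft_ι_mul _ _ _

theorem da_one (t : Finset (Fin 6)) : da F t (1 : Lam F) = 0 :=
  CliffordAlgebra.contractLeft_one _ _

theorem db_one (t : Finset (Fin 6)) : db F t (1 : Lam F) = 0 :=
  CliffordAlgebra.contractLeft_one _ _

theorem int2L_mul (t : Finset (Fin 6)) (x : (Bool × Finset (Fin 6)) → F) (z : Lam F)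
    (hx : ∀ s, x (s, t) = 0) :
    int2L F t (ExteriorAlgebra.ι F x * z) = ExteriorAlgebra.ι F x * int2L F t z := by
  simp [int2L, da_mul, db_mul, hx]

theorem int2L_one (t : Finset (Fin 6)) : int2L F t (1 : Lam F) = 0 := by
  simp [int2L, da_one]

theorem int2L_vec (t : Finset (Fin 6)) (x : (Bool × Finset (Fin 6)) → F) :
    int2L F t (ExteriorAlgebra.ι F x) = 0 := by
  have := da_mul F t x 1
  rw [mul_one, da_one, mul_zero, sub_zero] at this
  simp [int2L, this, db_one]

theorem int2L_two (t : Finset (Fin 6)) (x y : (Bool × Finset (Fin 6)) → F) :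
    int2L F t (ExteriorAlgebra.ι F x * ExteriorAlgebra.ι F y)
      = (x (false, t) * y (true, t) - x (true, t) * y (false, t)) • (1 : Lam F) := by
  have h1 := da_mul F t y 1
  rw [mul_one, da_one, mul_zero, sub_zero] at h1
  have h2 : ∀ y, db F t (ExteriorAlgebra.ι F y) = y (true, t) • (1 : Lam F) := fun y => by
    have h1 := db_mul F t y 1
    rwa [mul_one, db_one, mul_zero, sub_zero] at h1
  simp only [int2L, LinearMap.comp_apply, da_mul, h1, map_sub, map_smul, h2, mul_smul_comm,
    mul_one]
  module

/-- the result of the integration, as a polynomial in the four boundary vectors -/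
def Gp (k1 k2 k3 y11 y12 y13 y21 y22 y23 y31 y32 y33 : F) (e0 e1 e2 e3 : Lam F) : Lam F :=
  (-(y13*y22*k3) + y12*y23*k3 - y23*y31*k1 - y13*y32*k2 + y11*y33*k2 + y21*y33*k1) • (1 : Lam F)
        - (y11*k2*k3 + y21*k1*k3) • (e0 * e1)
        + (y31*k1*k2 - y12*k2*k3) • (e0 * e2)
        - (y22*k1*k3 + y32*k1*k2) • (e1 * e2)
        - (y13*k2*k3) • (e0 * e3)
        - (y23*k1*k3) • (e1 * e3)
        + (y33*k1*k2) • (e2 * e3)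
        - (k1*k2*k3) • (e0 * (e1 * (e2 * e3)))

theorem coreInt (p3 q3 r3 p2 q2 r2 p1 q1 r1 b : (Bool × Finset (Fin 6)) → F)
    (t1 t2 t3 : Finset (Fin 6)) (m : Fin 10 → ((Bool × Finset (Fin 6)) → F))
    (hm : m = ![p2 - p3, p1 + q3, q1 - q2, r1 - r2 + r3, q2, r2 + b, q3, r3 + b, -p3, b])
    (h1 : ∀ i, i < 8 → ∀ s, m i (s, t1) = 0)
    (h2 : ∀ i, i < 6 → ∀ s, m i (s, t2) = 0)
    (h3 : ∀ i, i < 4 → ∀ s, m i (s, t3) = 0)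
    (D1 D2 D3 : F)
    (hD1 : m 8 (false, t1) * m 9 (true, t1) - m 8 (true, t1) * m 9 (false, t1) = D1)
    (hD2 : m 6 (false, t2) * m 7 (true, t2) - m 6 (true, t2) * m 7 (false, t2) = D2)
    (hD3 : m 4 (false, t3) * m 5 (true, t3) - m 4 (true, t3) * m 5 (false, t3) = D3)
    (k1 k2 k3 y11 y12 y13 y21 y22 y23 y31 y32 y33 : F) (W1 W2 W3 : Lam F)
    (hW3 : W3 = k3 • (ExteriorAlgebra.ι F p3 * ExteriorAlgebra.ι F q3 * ExteriorAlgebra.ι F r3)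
      + (y31 • ExteriorAlgebra.ι F p3 + y32 • ExteriorAlgebra.ι F q3
        + y33 • ExteriorAlgebra.ι F r3))
    (hW2 : W2 = k2 • (ExteriorAlgebra.ι F p2 * ExteriorAlgebra.ι F q2 * ExteriorAlgebra.ι F r2)
      + (y21 • ExteriorAlgebra.ι F p2 + y22 • ExteriorAlgebra.ι F q2
        + y23 • ExteriorAlgebra.ι F r2))
    (hW1 : W1 = k1 • (ExteriorAlgebra.ι F p1 * ExteriorAlgebra.ι F q1 * ExteriorAlgebra.ι F r1)
      + (y11 • ExteriorAlgebra.ι F p1 + y12 • ExteriorAlgebra.ι F q1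
        + y13 • ExteriorAlgebra.ι F r1)) :
    int2 F t3 (int2 F t2 (int2 F t1 (W3 * W2 * W1 * ExteriorAlgebra.ι F b)))
    = (D1 * D2 * D3) • Gp F k1 k2 k3 y11 y12 y13 y21 y22 y23 y31 y32 y33
        (ExteriorAlgebra.ι F (p2 - p3)) (ExteriorAlgebra.ι F (p1 + q3))
        (ExteriorAlgebra.ι F (q1 - q2)) (ExteriorAlgebra.ι F (r1 - r2 + r3)) := by
  have key := core33 (F := F) (R := Lam F) (fun i => ExteriorAlgebra.ι F (m i))
    (fun i => ExteriorAlgebra.ι_sq_zero _) (fun i j => iota_anti F _ _)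
    (int2L F t1) (int2L F t2) (int2L F t3) D1 D2 D3
    (fun i z hi => int2L_mul F t1 _ z (h1 i hi)) (fun i => int2L_vec F t1 _)
    (by rw [int2L_two, hD1])
    (fun i z hi => int2L_mul F t2 _ z (h2 i hi)) (fun i => int2L_vec F t2 _) (int2L_one F t2)
    (by rw [int2L_two, hD2])
    (fun i z hi => int2L_mul F t3 _ z (h3 i hi)) (fun i => int2L_vec F t3 _) (int2L_one F t3)
    (by rw [int2L_two, hD3])
    k1 k2 k3 y11 y12 y13 y21 y22 y23 y31 y32 y33
  simp only [← map_neg, ← map_sub, ← map_add] at key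
  have e8 : - m 8 = p3 := by rw [hm]; simp
  have e6 : m 6 = q3 := by rw [hm]; rfl
  have e79 : m 7 - m 9 = r3 := by rw [hm]; simp
  have e08 : m 0 - m 8 = p2 := by rw [hm]; simp
  have e4 : m 4 = q2 := by rw [hm]; rfl
  have e59 : m 5 - m 9 = r2 := by rw [hm]; simp
  have e16 : m 1 - m 6 = p1 := by rw [hm]; simp
  have e24 : m 2 + m 4 = q1 := by rw [hm]; simp
  have e573 : m 5 - m 7 + m 3 = r1 := by
    rw [hm]; simp
  have e9 : m 9 = b := by rw [hm]; rfl
  have f0 : m 0 = p2 - p3 := by rw [hm]; rfl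
  have f1 : m 1 = p1 + q3 := by rw [hm]; rfl
  have f2 : m 2 = q1 - q2 := by rw [hm]; rfl
  have f3 : m 3 = r1 - r2 + r3 := by rw [hm]; rfl
  rw [e573, e79, e08, e59, e16, e24, e8, e4, e6, e9, f0, f1, f2, f3] at key
  rw [hW1, hW2, hW3]
  exact key

/-- vectors underlying `vv` -/
def vm (i j k l m : Fin 6) : Fin 5 → ((Bool × Finset (Fin 6)) → F) :=
  let a : Finset (Fin 6) → ((Bool × Finset (Fin 6)) → F) := fun t => Pi.single (false, t) 1
  let b : Finset (Fin 6) → ((Bool × Finset (Fin 6)) → F) := fun t => Pi.single (true, t) 1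
  let v1 :=
    (ζ k - ζ l) • a {i,j,k,l} - (ζ k - ζ m) • a {i,j,k,m}
      + (ζ l - ζ m) • a {i,j,l,m} - (ζ l - ζ m) • a {i,k,l,m}
  let v2 :=
    (ζ k - ζ l) • b {i,j,k,l} - (ζ k - ζ m) • b {i,j,k,m}
      + (ζ l - ζ m) • b {i,j,l,m} + (ζ l - ζ m) • a {j,k,l,m}
  let v3 :=
    -((ζ i - ζ l) • a {i,j,k,l}) - (ζ j - ζ l) • b {i,j,k,l}
      + (ζ i - ζ m) • a {i,j,k,m} + (ζ j - ζ m) • b {i,j,k,m}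
      - (ζ l - ζ m) • b {i,k,l,m} + (ζ l - ζ m) • b {j,k,l,m}
  ![v1, v2, v3,
    (ζ m - ζ l)⁻¹ • ((ζ i - ζ m) • v1 + (ζ j - ζ m) • v2 + (ζ k - ζ m) • v3),
    (ζ l - ζ m)⁻¹ • ((ζ i - ζ l) • v1 + (ζ j - ζ l) • v2 + (ζ k - ζ l) • v3)]

theorem vv_eq (i j k l m : Fin 6) (p : Fin 5) :
    vv F ζ i j k l m p = ExteriorAlgebra.ι F (vm F ζ i j k l m p) := by
  fin_cases p <;> simp [vv, vm, av, bv]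

theorem vm3 (i j k l m : Fin 6) : vm F ζ i j k l m 3 =
    (ζ m - ζ l)⁻¹ • ((ζ i - ζ m) • vm F ζ i j k l m 0 + (ζ j - ζ m) • vm F ζ i j k l m 1
      + (ζ k - ζ m) • vm F ζ i j k l m 2) := rfl

theorem vm4 (i j k l m : Fin 6) : vm F ζ i j k l m 4 =
    (ζ l - ζ m)⁻¹ • ((ζ i - ζ l) • vm F ζ i j k l m 0 + (ζ j - ζ l) • vm F ζ i j k l m 1
      + (ζ k - ζ l) • vm F ζ i j k l m 2) := rfl

theorem Wt_right (hζ : Function.Injective ζ) (eps : ℤ) (i j k l m : Fin 6) (hlm : l ≠ m)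
    (x3 x4 x5 : F) :
    Wt F ζ eps i j k l m ![0, 0, x3, x4, x5] =
      (ζ l - ζ m)⁻¹ • (ExteriorAlgebra.ι F (vm F ζ i j k l m 0)
        * ExteriorAlgebra.ι F (vm F ζ i j k l m 1) * ExteriorAlgebra.ι F (vm F ζ i j k l m 2))
      + (((eps : F) * (-(ζ i - ζ m) * x4 + (ζ i - ζ l) * x5) / (ζ l - ζ m))
            • ExteriorAlgebra.ι F (vm F ζ i j k l m 0)
        + ((eps : F) * (-(ζ j - ζ m) * x4 + (ζ j - ζ l) * x5) / (ζ l - ζ m))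
            • ExteriorAlgebra.ι F (vm F ζ i j k l m 1)
        + ((eps : F) * (x3 + (-(ζ k - ζ m) * x4 + (ζ k - ζ l) * x5) / (ζ l - ζ m)))
            • ExteriorAlgebra.ι F (vm F ζ i j k l m 2)) := by
  have h1 : ζ l - ζ m ≠ 0 := sub_ne_zero.2 (hζ.ne hlm)
  have h2 : ζ m - ζ l = -(ζ l - ζ m) := by ring
  simp only [Wt, vv_eq, Fin.sum_univ_five, vm3, vm4, h2, map_smul, map_add]
  simp only [Matrix.cons_val]
  match_scalars <;> field_simp <;> ring

theorem Wt_left (hζ : Function.Injective ζ) (eps : ℤ) (i j k l m : Fin 6) (hlm : l ≠ m)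
    (hjk : j ≠ k) (x1 x2 x3 : F) :
    Wt F ζ eps i j k l m ![x1, x2, x3, 0, 0] =
      (ζ j - ζ k)⁻¹ • (ExteriorAlgebra.ι F (vm F ζ i j k l m 3)
        * ExteriorAlgebra.ι F (vm F ζ i j k l m 4) * ExteriorAlgebra.ι F (vm F ζ i j k l m 0))
      + (((eps : F) * (-(ζ l - ζ k) * x2 + (ζ l - ζ j) * x3) / (ζ j - ζ k))
            • ExteriorAlgebra.ι F (vm F ζ i j k l m 3)
        + ((eps : F) * (-(ζ m - ζ k) * x2 + (ζ m - ζ j) * x3) / (ζ j - ζ k))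
            • ExteriorAlgebra.ι F (vm F ζ i j k l m 4)
        + ((eps : F) * (x1 + (-(ζ i - ζ k) * x2 + (ζ i - ζ j) * x3) / (ζ j - ζ k)))
            • ExteriorAlgebra.ι F (vm F ζ i j k l m 0)) := by
  have h1 : ζ l - ζ m ≠ 0 := sub_ne_zero.2 (hζ.ne hlm)
  have h3 : ζ j - ζ k ≠ 0 := sub_ne_zero.2 (hζ.ne hjk)
  have h2 : ζ m - ζ l = -(ζ l - ζ m) := by ring
  simp only [Wt, vv_eq, Fin.sum_univ_five, vm3, vm4, h2, map_smul, map_add]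
  simp only [Matrix.cons_val]
  generalize vm F ζ i j k l m 0 = a
  generalize vm F ζ i j k l m 1 = b
  generalize vm F ζ i j k l m 2 = c
  have a1 := iota_anti F b a
  have a2 := iota_anti F c a
  have a3 := iota_anti F c b
  have s1 := ExteriorAlgebra.ι_sq_zero (R := F) a
  have s2 := ExteriorAlgebra.ι_sq_zero (R := F) b
  have s3 := ExteriorAlgebra.ι_sq_zero (R := F) c
  generalize ExteriorAlgebra.ι F a = A at *
  generalize ExteriorAlgebra.ι F b = B at *
  generalize ExteriorAlgebra.ι F c = C at *
  have b1 : ∀ z, B * (A * z) = -(A * (B * z)) := fun z => by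
    rw [← mul_assoc, a1, neg_mul, mul_assoc]
  have b2 : ∀ z, C * (A * z) = -(A * (C * z)) := fun z => by
    rw [← mul_assoc, a2, neg_mul, mul_assoc]
  have b3 : ∀ z, C * (B * z) = -(B * (C * z)) := fun z => by
    rw [← mul_assoc, a3, neg_mul, mul_assoc]
  have t1 : ∀ z, A * (A * z) = 0 := fun z => by rw [← mul_assoc, s1, zero_mul]
  simp only [mul_add, add_mul, mul_assoc, smul_mul_assoc, mul_smul_comm, a1, a2, a3, s1, s2, s3,
    b1, b2, b3, t1, neg_mul, mul_neg, neg_neg, mul_zero, smul_zero, add_zero, zero_add, neg_zero]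
  match_scalars <;> field_simp <;> ring

theorem fin33 (v0 v1 v2 v3 : (Bool × Finset (Fin 6)) → F) (z1 z2 z3 z4 z5 z6 : F)
    (h23 : z2 - z3 ≠ 0) (h56 : z5 - z6 ≠ 0)
    (c14 c15 c16 c24 c25 c26 c34 c35 c36 : F) (w0 w1 w2 w3 : (Bool × Finset (Fin 6)) → F)
    (hw0 : w0 = -v3)
    (hw1 : w1 = (-(z5 - z6)⁻¹) • (-(z1 - z6) • v0 + (z2 - z6) • v1 + (z3 - z6) • v2
      + (z4 - z6) • v3))
    (hw2 : w2 = (z5 - z6)⁻¹ • (-(z1 - z5) • v0 + (z2 - z5) • v1 + (z3 - z5) • v2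
      + (z4 - z5) • v3))
    (hw3 : w3 = -v0) :
    (z2 - z3) ^ 2 • Gp F (z2 - z3)⁻¹ (z2 - z3)⁻¹ (z2 - z3)⁻¹
        (1 * (-(z5 - z3) * c24 + (z5 - z2) * c34) / (z2 - z3))
        (1 * (-(z6 - z3) * c24 + (z6 - z2) * c34) / (z2 - z3))
        (1 * (c14 + (-(z1 - z3) * c24 + (z1 - z2) * c34) / (z2 - z3)))
        (-1 * (-(z4 - z3) * c25 + (z4 - z2) * c35) / (z2 - z3))
        (-1 * (-(z6 - z3) * c25 + (z6 - z2) * c35) / (z2 - z3))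
        (-1 * (c15 + (-(z1 - z3) * c25 + (z1 - z2) * c35) / (z2 - z3)))
        (1 * (-(z4 - z3) * c26 + (z4 - z2) * c36) / (z2 - z3))
        (1 * (-(z5 - z3) * c26 + (z5 - z2) * c36) / (z2 - z3))
        (1 * (c16 + (-(z1 - z3) * c26 + (z1 - z2) * c36) / (z2 - z3)))
        (ExteriorAlgebra.ι F w0) (ExteriorAlgebra.ι F w1) (ExteriorAlgebra.ι F w2)
        (ExteriorAlgebra.ι F w3)
    = (-(z5 - z6) ^ 2) • Gp F (z5 - z6)⁻¹ (z5 - z6)⁻¹ (z5 - z6)⁻¹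
        (1 * (-(z2 - z6) * c15 + (z2 - z5) * c16) / (z5 - z6))
        (1 * (-(z3 - z6) * c15 + (z3 - z5) * c16) / (z5 - z6))
        (1 * (c14 + (-(z4 - z6) * c15 + (z4 - z5) * c16) / (z5 - z6)))
        (-1 * (-(z1 - z6) * c25 + (z1 - z5) * c26) / (z5 - z6))
        (-1 * (-(z3 - z6) * c25 + (z3 - z5) * c26) / (z5 - z6))
        (-1 * (c24 + (-(z4 - z6) * c25 + (z4 - z5) * c26) / (z5 - z6)))
        (1 * (-(z1 - z6) * c35 + (z1 - z5) * c36) / (z5 - z6))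
        (1 * (-(z2 - z6) * c35 + (z2 - z5) * c36) / (z5 - z6))
        (1 * (c34 + (-(z4 - z6) * c35 + (z4 - z5) * c36) / (z5 - z6)))
        (ExteriorAlgebra.ι F v0) (ExteriorAlgebra.ι F v1) (ExteriorAlgebra.ι F v2)
        (ExteriorAlgebra.ι F v3) := by
  subst hw0 hw1 hw2 hw3
  simp only [map_neg, map_smul, map_add, Gp]
  have a1 := iota_anti F v1 v0
  have a2 := iota_anti F v2 v0
  have a3 := iota_anti F v3 v0
  have a4 := iota_anti F v2 v1
  have a5 := iota_anti F v3 v1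
  have a6 := iota_anti F v3 v2
  have s0 := ExteriorAlgebra.ι_sq_zero (R := F) v0
  have s1 := ExteriorAlgebra.ι_sq_zero (R := F) v1
  have s2 := ExteriorAlgebra.ι_sq_zero (R := F) v2
  have s3 := ExteriorAlgebra.ι_sq_zero (R := F) v3
  generalize ExteriorAlgebra.ι F v0 = A at *
  generalize ExteriorAlgebra.ι F v1 = B at *
  generalize ExteriorAlgebra.ι F v2 = C at *
  generalize ExteriorAlgebra.ι F v3 = D at *
  have sw : ∀ x y : Lam F, x * y = -(y * x) → ∀ z, x * (y * z) = -(y * (x * z)) :=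
    fun x y h z => by rw [← mul_assoc, h, neg_mul, mul_assoc]
  have sq : ∀ x : Lam F, x * x = 0 → ∀ z, x * (x * z) = 0 :=
    fun x h z => by rw [← mul_assoc, h, zero_mul]
  have b1 := sw _ _ a1
  have b2 := sw _ _ a2
  have b3 := sw _ _ a3
  have b4 := sw _ _ a4
  have b5 := sw _ _ a5
  have b6 := sw _ _ a6
  have t0 := sq _ s0
  have t1 := sq _ s1
  have t2 := sq _ s2
  have t3 := sq _ s3
  clear sw sq
  simp only [mul_add, add_mul, mul_assoc, smul_mul_assoc, mul_smul_comm, a1, a2, a3, a4, a5, a6,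
    s0, s1, s2, s3, b1, b2, b3, b4, b5, b6, t0, t1, t2, t3, neg_mul, mul_neg, neg_neg, smul_neg,
    mul_zero, smul_zero, add_zero, zero_add, neg_zero, neg_smul]
  match_scalars <;> field_simp <;> ring

/-- indicator of equality of tetrahedra -/
def ind (t t' : Finset (Fin 6)) : F := if t = t' then 1 else 0

theorem ind_self (t : Finset (Fin 6)) : ind F t t = 1 := if_pos rfl

theorem ind_ne (t t' : Finset (Fin 6)) (h : t ≠ t') : ind F t t' = 0 := if_neg h

theorem single_ff (t t' : Finset (Fin 6)) :
    (Pi.single (false, t) 1 : (Bool × Finset (Fin 6)) → F) (false, t') = ind F t' t := by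
  simp [Pi.single_apply, ind]

theorem single_ft (t t' : Finset (Fin 6)) :
    (Pi.single (false, t) 1 : (Bool × Finset (Fin 6)) → F) (true, t') = 0 := by
  simp [Pi.single_apply]

theorem single_tf (t t' : Finset (Fin 6)) :
    (Pi.single (true, t) 1 : (Bool × Finset (Fin 6)) → F) (false, t') = 0 := by
  simp [Pi.single_apply]

theorem single_tt (t t' : Finset (Fin 6)) :
    (Pi.single (true, t) 1 : (Bool × Finset (Fin 6)) → F) (true, t') = ind F t' t := by
  simp [Pi.single_apply, ind]

theorem vm0f (i j k l m : Fin 6) (t : Finset (Fin 6)) : vm F ζ i j k l m 0 (false, t) =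
    (ζ k - ζ l) * ind F t {i,j,k,l} - (ζ k - ζ m) * ind F t {i,j,k,m}
      + (ζ l - ζ m) * ind F t {i,j,l,m} - (ζ l - ζ m) * ind F t {i,k,l,m} := by
  simp [vm, single_ff]

theorem vm0t (i j k l m : Fin 6) (t : Finset (Fin 6)) : vm F ζ i j k l m 0 (true, t) = 0 := by
  simp [vm, single_ft]

theorem vm1f (i j k l m : Fin 6) (t : Finset (Fin 6)) : vm F ζ i j k l m 1 (false, t) =
    (ζ l - ζ m) * ind F t {j,k,l,m} := by
  simp [vm, single_ff, single_tf]

theorem vm1t (i j k l m : Fin 6) (t : Finset (Fin 6)) : vm F ζ i j k l m 1 (true, t) =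
    (ζ k - ζ l) * ind F t {i,j,k,l} - (ζ k - ζ m) * ind F t {i,j,k,m}
      + (ζ l - ζ m) * ind F t {i,j,l,m} := by
  simp [vm, single_tt, single_ft]

theorem vm2f (i j k l m : Fin 6) (t : Finset (Fin 6)) : vm F ζ i j k l m 2 (false, t) =
    -((ζ i - ζ l) * ind F t {i,j,k,l}) + (ζ i - ζ m) * ind F t {i,j,k,m} := by
  simp [vm, single_ff, single_tf]

theorem vm2t (i j k l m : Fin 6) (t : Finset (Fin 6)) : vm F ζ i j k l m 2 (true, t) =
    -((ζ j - ζ l) * ind F t {i,j,k,l}) + (ζ j - ζ m) * ind F t {i,j,k,m}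
      - (ζ l - ζ m) * ind F t {i,k,l,m} + (ζ l - ζ m) * ind F t {j,k,l,m} := by
  simp [vm, single_tt, single_ft]

theorem vm3a (i j k l m : Fin 6) (s : Bool × Finset (Fin 6)) : vm F ζ i j k l m 3 s =
    (ζ m - ζ l)⁻¹ * ((ζ i - ζ m) * vm F ζ i j k l m 0 s + (ζ j - ζ m) * vm F ζ i j k l m 1 s
      + (ζ k - ζ m) * vm F ζ i j k l m 2 s) := rfl

theorem vm4a (i j k l m : Fin 6) (s : Bool × Finset (Fin 6)) : vm F ζ i j k l m 4 s =
    (ζ l - ζ m)⁻¹ * ((ζ i - ζ l) * vm F ζ i j k l m 0 s + (ζ j - ζ l) * vm F ζ i j k l m 1 s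
      + (ζ k - ζ l) * vm F ζ i j k l m 2 s) := rfl

/-- evaluation of a list of ten vectors -/
theorem free8 (x0 x1 x2 x3 x4 x5 x6 x7 x8 x9 : (Bool × Finset (Fin 6)) → F)
    (t : Finset (Fin 6))
    (h0 : ∀ s, x0 (s, t) = 0) (h1 : ∀ s, x1 (s, t) = 0) (h2 : ∀ s, x2 (s, t) = 0)
    (h3 : ∀ s, x3 (s, t) = 0) (h4 : ∀ s, x4 (s, t) = 0) (h5 : ∀ s, x5 (s, t) = 0)
    (h6 : ∀ s, x6 (s, t) = 0) (h7 : ∀ s, x7 (s, t) = 0) :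
    ∀ i, i < 8 → ∀ s, (![x0,x1,x2,x3,x4,x5,x6,x7,x8,x9] : Fin 10 → _) i (s, t) = 0 := by
  intro i hi s
  fin_cases i
  exacts [h0 s, h1 s, h2 s, h3 s, h4 s, h5 s, h6 s, h7 s, absurd hi (by decide),
    absurd hi (by decide)]

theorem free6 (x0 x1 x2 x3 x4 x5 x6 x7 x8 x9 : (Bool × Finset (Fin 6)) → F)
    (t : Finset (Fin 6))
    (h0 : ∀ s, x0 (s, t) = 0) (h1 : ∀ s, x1 (s, t) = 0) (h2 : ∀ s, x2 (s, t) = 0)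
    (h3 : ∀ s, x3 (s, t) = 0) (h4 : ∀ s, x4 (s, t) = 0) (h5 : ∀ s, x5 (s, t) = 0) :
    ∀ i, i < 6 → ∀ s, (![x0,x1,x2,x3,x4,x5,x6,x7,x8,x9] : Fin 10 → _) i (s, t) = 0 := by
  intro i hi s
  fin_cases i
  exacts [h0 s, h1 s, h2 s, h3 s, h4 s, h5 s, absurd hi (by decide), absurd hi (by decide),
    absurd hi (by decide), absurd hi (by decide)]

theorem free4 (x0 x1 x2 x3 x4 x5 x6 x7 x8 x9 : (Bool × Finset (Fin 6)) → F)
    (t : Finset (Fin 6))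
    (h0 : ∀ s, x0 (s, t) = 0) (h1 : ∀ s, x1 (s, t) = 0) (h2 : ∀ s, x2 (s, t) = 0)
    (h3 : ∀ s, x3 (s, t) = 0) :
    ∀ i, i < 4 → ∀ s, (![x0,x1,x2,x3,x4,x5,x6,x7,x8,x9] : Fin 10 → _) i (s, t) = 0 := by
  intro i hi s
  fin_cases i
  exacts [h0 s, h1 s, h2 s, h3 s, absurd hi (by decide), absurd hi (by decide),
    absurd hi (by decide), absurd hi (by decide), absurd hi (by decide), absurd hi (by decide)]

theorem xchL (c : Finset (Fin 6) → F) (inner : Finset (Finset (Fin 6))) (i j k l m : Fin 6)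
    (t0 t1 t2 : Finset (Fin 6))
    (h0 : ({i,j,k,l,m} : Finset (Fin 6)).erase i = t0)
    (h1 : ({i,j,k,l,m} : Finset (Fin 6)).erase j = t1)
    (h2 : ({i,j,k,l,m} : Finset (Fin 6)).erase k = t2)
    (n0 : t0 ∉ inner) (n1 : t1 ∉ inner) (n2 : t2 ∉ inner)
    (h3 : ({i,j,k,l,m} : Finset (Fin 6)).erase l ∈ inner)
    (h4 : ({i,j,k,l,m} : Finset (Fin 6)).erase m ∈ inner) :
    xch F c inner i j k l m = ![c t0, c t1, c t2, 0, 0] := by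
  subst h0 h1 h2
  funext p
  fin_cases p
  · exact if_neg n0
  · exact if_neg n1
  · exact if_neg n2
  · exact if_pos h3
  · exact if_pos h4

theorem xchR (c : Finset (Fin 6) → F) (inner : Finset (Finset (Fin 6))) (i j k l m : Fin 6)
    (t2 t3 t4 : Finset (Fin 6))
    (h2 : ({i,j,k,l,m} : Finset (Fin 6)).erase k = t2)
    (h3 : ({i,j,k,l,m} : Finset (Fin 6)).erase l = t3)
    (h4 : ({i,j,k,l,m} : Finset (Fin 6)).erase m = t4)
    (n2 : t2 ∉ inner) (n3 : t3 ∉ inner) (n4 : t4 ∉ inner)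
    (h0 : ({i,j,k,l,m} : Finset (Fin 6)).erase i ∈ inner)
    (h1 : ({i,j,k,l,m} : Finset (Fin 6)).erase j ∈ inner) :
    xch F c inner i j k l m = ![0, 0, c t2, c t3, c t4] := by
  subst h2 h3 h4
  funext p
  fin_cases p
  · exact if_pos h0
  · exact if_pos h1
  · exact if_neg n2
  · exact if_neg n3
  · exact if_neg n4

theorem lhs33 (hζ : Function.Injective ζ) (c : Finset (Fin 6) → F) :
    int2 F {0,1,2,5} (int2 F {0,1,2,4} (int2 F {0,1,2,3}
        (Wt F ζ 1 0 1 2 3 4 (xch F c {{0,1,2,3},{0,1,2,4},{0,1,2,5}} 0 1 2 3 4) *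
         Wt F ζ (-1) 0 1 2 3 5 (xch F c {{0,1,2,3},{0,1,2,4},{0,1,2,5}} 0 1 2 3 5) *
         Wt F ζ 1 0 1 2 4 5 (xch F c {{0,1,2,3},{0,1,2,4},{0,1,2,5}} 0 1 2 4 5) *
         ExteriorAlgebra.ι F ((-(ζ 2 - ζ 3)) • Pi.single (false, {0,1,2,3}) 1)))) =
    (-((ζ 1 - ζ 2) * (ζ 2 - ζ 3)) * -((ζ 1 - ζ 2) * (ζ 2 - ζ 4)) * -((ζ 1 - ζ 2) * (ζ 2 - ζ 5))) •
      Gp F (ζ 1 - ζ 2)⁻¹ (ζ 1 - ζ 2)⁻¹ (ζ 1 - ζ 2)⁻¹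
        (1 * (-(ζ 4 - ζ 2) * c {0, 2, 4, 5} + (ζ 4 - ζ 1) * c {0, 1, 4, 5}) / (ζ 1 - ζ 2))
        (1 * (-(ζ 5 - ζ 2) * c {0, 2, 4, 5} + (ζ 5 - ζ 1) * c {0, 1, 4, 5}) / (ζ 1 - ζ 2))
        (1 * (c {1, 2, 4, 5} + (-(ζ 0 - ζ 2) * c {0, 2, 4, 5} + (ζ 0 - ζ 1) * c {0, 1, 4, 5}) / (ζ 1 - ζ 2)))
        (-1 * (-(ζ 3 - ζ 2) * c {0, 2, 3, 5} + (ζ 3 - ζ 1) * c {0, 1, 3, 5}) / (ζ 1 - ζ 2))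
        (-1 * (-(ζ 5 - ζ 2) * c {0, 2, 3, 5} + (ζ 5 - ζ 1) * c {0, 1, 3, 5}) / (ζ 1 - ζ 2))
        (-1 * (c {1, 2, 3, 5} + (-(ζ 0 - ζ 2) * c {0, 2, 3, 5} + (ζ 0 - ζ 1) * c {0, 1, 3, 5}) / (ζ 1 - ζ 2)))
        (1 * (-(ζ 3 - ζ 2) * c {0, 2, 3, 4} + (ζ 3 - ζ 1) * c {0, 1, 3, 4}) / (ζ 1 - ζ 2))
        (1 * (-(ζ 4 - ζ 2) * c {0, 2, 3, 4} + (ζ 4 - ζ 1) * c {0, 1, 3, 4}) / (ζ 1 - ζ 2))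
        (1 * (c {1, 2, 3, 4} + (-(ζ 0 - ζ 2) * c {0, 2, 3, 4} + (ζ 0 - ζ 1) * c {0, 1, 3, 4}) / (ζ 1 - ζ 2)))
        (ExteriorAlgebra.ι F (vm F ζ 0 1 2 3 5 3 - vm F ζ 0 1 2 3 4 3))
        (ExteriorAlgebra.ι F (vm F ζ 0 1 2 4 5 3 + vm F ζ 0 1 2 3 4 4))
        (ExteriorAlgebra.ι F (vm F ζ 0 1 2 4 5 4 - vm F ζ 0 1 2 3 5 4))
        (ExteriorAlgebra.ι F (vm F ζ 0 1 2 4 5 0 - vm F ζ 0 1 2 3 5 0 + vm F ζ 0 1 2 3 4 0)) := by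
  have h34 : ζ 3 - ζ 4 ≠ 0 := sub_ne_zero.2 (hζ.ne (by decide))
  have h35 : ζ 3 - ζ 5 ≠ 0 := sub_ne_zero.2 (hζ.ne (by decide))
  have h45 : ζ 4 - ζ 5 ≠ 0 := sub_ne_zero.2 (hζ.ne (by decide))
  have h43 : ζ 4 - ζ 3 ≠ 0 := sub_ne_zero.2 (hζ.ne (by decide))
  have h53 : ζ 5 - ζ 3 ≠ 0 := sub_ne_zero.2 (hζ.ne (by decide))
  have h54 : ζ 5 - ζ 4 ≠ 0 := sub_ne_zero.2 (hζ.ne (by decide))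
  rw [xchL F c _ 0 1 2 3 4 {1,2,3,4} {0,2,3,4} {0,1,3,4} (by decide) (by decide) (by decide)
      (by decide) (by decide) (by decide) (by decide) (by decide),
    xchL F c _ 0 1 2 3 5 {1,2,3,5} {0,2,3,5} {0,1,3,5} (by decide) (by decide) (by decide)
      (by decide) (by decide) (by decide) (by decide) (by decide),
    xchL F c _ 0 1 2 4 5 {1,2,4,5} {0,2,4,5} {0,1,4,5} (by decide) (by decide) (by decide)
      (by decide) (by decide) (by decide) (by decide) (by decide)]
  rw [coreInt F _ _ _ _ _ _ _ _ _ _ {0,1,2,3} {0,1,2,4} {0,1,2,5} _ rfl ?_ ?_ ?_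
    (-((ζ 1 - ζ 2) * (ζ 2 - ζ 3))) (-((ζ 1 - ζ 2) * (ζ 2 - ζ 4))) (-((ζ 1 - ζ 2) * (ζ 2 - ζ 5)))
    ?_ ?_ ?_ _ _ _ _ _ _ _ _ _ _ _ _ _ _ _
    (Wt_left F ζ hζ 1 0 1 2 3 4 (by decide) (by decide) _ _ _)
    (Wt_left F ζ hζ (-1) 0 1 2 3 5 (by decide) (by decide) _ _ _)
    (Wt_left F ζ hζ 1 0 1 2 4 5 (by decide) (by decide) _ _ _)]
  · push_cast
    rfl
  · refine free8 F _ _ _ _ _ _ _ _ _ _ _ ?_ ?_ ?_ ?_ ?_ ?_ ?_ ?_ <;> rintro (_ | _) <;>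
    simp (discharger := decide) only [Pi.add_apply, Pi.sub_apply, Pi.neg_apply, Pi.smul_apply,
      smul_eq_mul, single_ff, single_ft, single_tf, single_tt, vm3a, vm4a, vm0f, vm0t, vm1f, vm1t,
      vm2f, vm2t, ind_self, ind_ne, mul_zero, mul_one, add_zero, zero_add, sub_zero, zero_sub,
      neg_zero, sub_self] <;>
    try first | ring1 | (field_simp; ring1) | field_simp
  · refine free6 F _ _ _ _ _ _ _ _ _ _ _ ?_ ?_ ?_ ?_ ?_ ?_ <;> rintro (_ | _) <;>
    simp (discharger := decide) only [Pi.add_apply, Pi.sub_apply, Pi.neg_apply, Pi.smul_apply,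
      smul_eq_mul, single_ff, single_ft, single_tf, single_tt, vm3a, vm4a, vm0f, vm0t, vm1f, vm1t,
      vm2f, vm2t, ind_self, ind_ne, mul_zero, mul_one, add_zero, zero_add, sub_zero, zero_sub,
      neg_zero, sub_self] <;>
    try first | ring1 | (field_simp; ring1) | field_simp
  · refine free4 F _ _ _ _ _ _ _ _ _ _ _ ?_ ?_ ?_ ?_ <;> rintro (_ | _) <;>
    simp (discharger := decide) only [Pi.add_apply, Pi.sub_apply, Pi.neg_apply, Pi.smul_apply,
      smul_eq_mul, single_ff, single_ft, single_tf, single_tt, vm3a, vm4a, vm0f, vm0t, vm1f, vm1t,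
      vm2f, vm2t, ind_self, ind_ne, mul_zero, mul_one, add_zero, zero_add, sub_zero, zero_sub,
      neg_zero, sub_self] <;>
    try first | ring1 | (field_simp; ring1) | field_simp
  · simp only [Matrix.cons_val]
    simp (discharger := decide) only [Pi.add_apply, Pi.sub_apply, Pi.neg_apply, Pi.smul_apply,
      smul_eq_mul, single_ff, single_ft, single_tf, single_tt, vm3a, vm4a, vm0f, vm0t, vm1f, vm1t,
      vm2f, vm2t, ind_self, ind_ne, mul_zero, mul_one, add_zero, zero_add, sub_zero, zero_sub,
      neg_zero, sub_self]
    try first | ring1 | (field_simp; ring1) | field_simp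
  · simp only [Matrix.cons_val]
    simp (discharger := decide) only [Pi.add_apply, Pi.sub_apply, Pi.neg_apply, Pi.smul_apply,
      smul_eq_mul, single_ff, single_ft, single_tf, single_tt, vm3a, vm4a, vm0f, vm0t, vm1f, vm1t,
      vm2f, vm2t, ind_self, ind_ne, mul_zero, mul_one, add_zero, zero_add, sub_zero, zero_sub,
      neg_zero, sub_self]
    try first | ring1 | (field_simp; ring1) | field_simp
  · simp only [Matrix.cons_val]
    simp (discharger := decide) only [Pi.add_apply, Pi.sub_apply, Pi.neg_apply, Pi.smul_apply,
      smul_eq_mul, single_ff, single_ft, single_tf, single_tt, vm3a, vm4a, vm0f, vm0t, vm1f, vm1t,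
      vm2f, vm2t, ind_self, ind_ne, mul_zero, mul_one, add_zero, zero_add, sub_zero, zero_sub,
      neg_zero, sub_self]
    try first | ring1 | (field_simp; ring1) | field_simp

theorem rhs33 (hζ : Function.Injective ζ) (c : Finset (Fin 6) → F) :
    int2 F {2,3,4,5} (int2 F {1,3,4,5} (int2 F {0,3,4,5}
          (Wt F ζ 1 0 1 3 4 5 (xch F c {{0,3,4,5},{1,3,4,5},{2,3,4,5}} 0 1 3 4 5) *
           Wt F ζ (-1) 0 2 3 4 5 (xch F c {{0,3,4,5},{1,3,4,5},{2,3,4,5}} 0 2 3 4 5) *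
           Wt F ζ 1 1 2 3 4 5 (xch F c {{0,3,4,5},{1,3,4,5},{2,3,4,5}} 1 2 3 4 5) *
         ExteriorAlgebra.ι F ((ζ 4 - ζ 5) • Pi.single (true, {0,3,4,5}) 1)))) =
    ((ζ 4 - ζ 5) ^ 2 * (ζ 4 - ζ 5) ^ 2 * (ζ 4 - ζ 5) ^ 2) •
      Gp F (ζ 4 - ζ 5)⁻¹ (ζ 4 - ζ 5)⁻¹ (ζ 4 - ζ 5)⁻¹
        (1 * (-(ζ 1 - ζ 5) * c {1,2,3,5} + (ζ 1 - ζ 4) * c {1,2,3,4}) / (ζ 4 - ζ 5))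
        (1 * (-(ζ 2 - ζ 5) * c {1,2,3,5} + (ζ 2 - ζ 4) * c {1,2,3,4}) / (ζ 4 - ζ 5))
        (1 * (c {1,2,4,5} + (-(ζ 3 - ζ 5) * c {1,2,3,5} + (ζ 3 - ζ 4) * c {1,2,3,4}) / (ζ 4 - ζ 5)))
        (-1 * (-(ζ 0 - ζ 5) * c {0,2,3,5} + (ζ 0 - ζ 4) * c {0,2,3,4}) / (ζ 4 - ζ 5))
        (-1 * (-(ζ 2 - ζ 5) * c {0,2,3,5} + (ζ 2 - ζ 4) * c {0,2,3,4}) / (ζ 4 - ζ 5))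
        (-1 * (c {0,2,4,5} + (-(ζ 3 - ζ 5) * c {0,2,3,5} + (ζ 3 - ζ 4) * c {0,2,3,4}) / (ζ 4 - ζ 5)))
        (1 * (-(ζ 0 - ζ 5) * c {0,1,3,5} + (ζ 0 - ζ 4) * c {0,1,3,4}) / (ζ 4 - ζ 5))
        (1 * (-(ζ 1 - ζ 5) * c {0,1,3,5} + (ζ 1 - ζ 4) * c {0,1,3,4}) / (ζ 4 - ζ 5))
        (1 * (c {0,1,4,5} + (-(ζ 3 - ζ 5) * c {0,1,3,5} + (ζ 3 - ζ 4) * c {0,1,3,4}) / (ζ 4 - ζ 5)))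
        (ExteriorAlgebra.ι F (vm F ζ 0 2 3 4 5 0 - vm F ζ 0 1 3 4 5 0))
        (ExteriorAlgebra.ι F (vm F ζ 1 2 3 4 5 0 + vm F ζ 0 1 3 4 5 1))
        (ExteriorAlgebra.ι F (vm F ζ 1 2 3 4 5 1 - vm F ζ 0 2 3 4 5 1))
        (ExteriorAlgebra.ι F (vm F ζ 1 2 3 4 5 2 - vm F ζ 0 2 3 4 5 2 + vm F ζ 0 1 3 4 5 2)) := by
  rw [xchR F c _ 0 1 3 4 5 {0,1,4,5} {0,1,3,5} {0,1,3,4} (by decide) (by decide) (by decide)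
      (by decide) (by decide) (by decide) (by decide) (by decide),
    xchR F c _ 0 2 3 4 5 {0,2,4,5} {0,2,3,5} {0,2,3,4} (by decide) (by decide) (by decide)
      (by decide) (by decide) (by decide) (by decide) (by decide),
    xchR F c _ 1 2 3 4 5 {1,2,4,5} {1,2,3,5} {1,2,3,4} (by decide) (by decide) (by decide)
      (by decide) (by decide) (by decide) (by decide) (by decide)]
  rw [coreInt F _ _ _ _ _ _ _ _ _ _ {0,3,4,5} {1,3,4,5} {2,3,4,5} _ rfl ?_ ?_ ?_
    ((ζ 4 - ζ 5) ^ 2) ((ζ 4 - ζ 5) ^ 2) ((ζ 4 - ζ 5) ^ 2)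
    ?_ ?_ ?_ _ _ _ _ _ _ _ _ _ _ _ _ _ _ _
    (Wt_right F ζ hζ 1 0 1 3 4 5 (by decide) _ _ _)
    (Wt_right F ζ hζ (-1) 0 2 3 4 5 (by decide) _ _ _)
    (Wt_right F ζ hζ 1 1 2 3 4 5 (by decide) _ _ _)]
  · push_cast
    rfl
  · refine free8 F _ _ _ _ _ _ _ _ _ _ _ ?_ ?_ ?_ ?_ ?_ ?_ ?_ ?_ <;> rintro (_ | _) <;>
    simp (discharger := decide) only [Pi.add_apply, Pi.sub_apply, Pi.neg_apply, Pi.smul_apply,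
      smul_eq_mul, single_ff, single_ft, single_tf, single_tt, vm3a, vm4a, vm0f, vm0t, vm1f, vm1t,
      vm2f, vm2t, ind_self, ind_ne, mul_zero, mul_one, add_zero, zero_add, sub_zero, zero_sub,
      neg_zero, sub_self] <;>
    try first | ring1 | (field_simp; ring1) | field_simp
  · refine free6 F _ _ _ _ _ _ _ _ _ _ _ ?_ ?_ ?_ ?_ ?_ ?_ <;> rintro (_ | _) <;>
    simp (discharger := decide) only [Pi.add_apply, Pi.sub_apply, Pi.neg_apply, Pi.smul_apply,
      smul_eq_mul, single_ff, single_ft, single_tf, single_tt, vm3a, vm4a, vm0f, vm0t, vm1f, vm1t,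
      vm2f, vm2t, ind_self, ind_ne, mul_zero, mul_one, add_zero, zero_add, sub_zero, zero_sub,
      neg_zero, sub_self] <;>
    try first | ring1 | (field_simp; ring1) | field_simp
  · refine free4 F _ _ _ _ _ _ _ _ _ _ _ ?_ ?_ ?_ ?_ <;> rintro (_ | _) <;>
    simp (discharger := decide) only [Pi.add_apply, Pi.sub_apply, Pi.neg_apply, Pi.smul_apply,
      smul_eq_mul, single_ff, single_ft, single_tf, single_tt, vm3a, vm4a, vm0f, vm0t, vm1f, vm1t,
      vm2f, vm2t, ind_self, ind_ne, mul_zero, mul_one, add_zero, zero_add, sub_zero, zero_sub,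
      neg_zero, sub_self] <;>
    try first | ring1 | (field_simp; ring1) | field_simp
  · simp only [Matrix.cons_val]
    simp (discharger := decide) only [Pi.add_apply, Pi.sub_apply, Pi.neg_apply, Pi.smul_apply,
      smul_eq_mul, single_ff, single_ft, single_tf, single_tt, vm3a, vm4a, vm0f, vm0t, vm1f, vm1t,
      vm2f, vm2t, ind_self, ind_ne, mul_zero, mul_one, add_zero, zero_add, sub_zero, zero_sub,
      neg_zero, sub_self]
    try first | ring1 | (field_simp; ring1) | field_simp
  · simp only [Matrix.cons_val]
    simp (discharger := decide) only [Pi.add_apply, Pi.sub_apply, Pi.neg_apply, Pi.smul_apply,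
      smul_eq_mul, single_ff, single_ft, single_tf, single_tt, vm3a, vm4a, vm0f, vm0t, vm1f, vm1t,
      vm2f, vm2t, ind_self, ind_ne, mul_zero, mul_one, add_zero, zero_add, sub_zero, zero_sub,
      neg_zero, sub_self]
    try first | ring1 | (field_simp; ring1) | field_simp
  · simp only [Matrix.cons_val]
    simp (discharger := decide) only [Pi.add_apply, Pi.sub_apply, Pi.neg_apply, Pi.smul_apply,
      smul_eq_mul, single_ff, single_ft, single_tf, single_tt, vm3a, vm4a, vm0f, vm0t, vm1f, vm1t,
      vm2f, vm2t, ind_self, ind_ne, mul_zero, mul_one, add_zero, zero_add, sub_zero, zero_sub,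
      neg_zero, sub_self]
    try first | ring1 | (field_simp; ring1) | field_simp

theorem rel_w3 : vm F ζ 0 1 2 4 5 0 - vm F ζ 0 1 2 3 5 0 + vm F ζ 0 1 2 3 4 0
    = -(vm F ζ 0 2 3 4 5 0 - vm F ζ 0 1 3 4 5 0) := by
  funext ⟨s, t⟩
  cases s <;> simp only [Pi.add_apply, Pi.sub_apply, Pi.neg_apply, vm0f, vm0t] <;> ring

theorem rel_w0 (hζ : Function.Injective ζ) : vm F ζ 0 1 2 3 5 3 - vm F ζ 0 1 2 3 4 3
    = -(vm F ζ 1 2 3 4 5 2 - vm F ζ 0 2 3 4 5 2 + vm F ζ 0 1 3 4 5 2) := by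
  have h34 : ζ 3 - ζ 4 ≠ 0 := sub_ne_zero.2 (hζ.ne (by decide))
  have h35 : ζ 3 - ζ 5 ≠ 0 := sub_ne_zero.2 (hζ.ne (by decide))
  have h45 : ζ 4 - ζ 5 ≠ 0 := sub_ne_zero.2 (hζ.ne (by decide))
  have h43 : ζ 4 - ζ 3 ≠ 0 := sub_ne_zero.2 (hζ.ne (by decide))
  have h53 : ζ 5 - ζ 3 ≠ 0 := sub_ne_zero.2 (hζ.ne (by decide))
  have h54 : ζ 5 - ζ 4 ≠ 0 := sub_ne_zero.2 (hζ.ne (by decide))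
  funext ⟨s, t⟩
  cases s <;> simp only [Pi.add_apply, Pi.sub_apply, Pi.neg_apply, Pi.smul_apply, smul_eq_mul,
    vm3a, vm4a, vm0f, vm0t, vm1f, vm1t, vm2f, vm2t] <;> field_simp <;> ring

theorem rel_w1 (hζ : Function.Injective ζ) : vm F ζ 0 1 2 4 5 3 + vm F ζ 0 1 2 3 4 4
    = (-(ζ 4 - ζ 5)⁻¹) • (-(ζ 0 - ζ 5) • (vm F ζ 0 2 3 4 5 0 - vm F ζ 0 1 3 4 5 0)
      + (ζ 1 - ζ 5) • (vm F ζ 1 2 3 4 5 0 + vm F ζ 0 1 3 4 5 1)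
      + (ζ 2 - ζ 5) • (vm F ζ 1 2 3 4 5 1 - vm F ζ 0 2 3 4 5 1)
      + (ζ 3 - ζ 5) • (vm F ζ 1 2 3 4 5 2 - vm F ζ 0 2 3 4 5 2 + vm F ζ 0 1 3 4 5 2)) := by
  have h34 : ζ 3 - ζ 4 ≠ 0 := sub_ne_zero.2 (hζ.ne (by decide))
  have h35 : ζ 3 - ζ 5 ≠ 0 := sub_ne_zero.2 (hζ.ne (by decide))
  have h45 : ζ 4 - ζ 5 ≠ 0 := sub_ne_zero.2 (hζ.ne (by decide))
  have h43 : ζ 4 - ζ 3 ≠ 0 := sub_ne_zero.2 (hζ.ne (by decide))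
  have h53 : ζ 5 - ζ 3 ≠ 0 := sub_ne_zero.2 (hζ.ne (by decide))
  have h54 : ζ 5 - ζ 4 ≠ 0 := sub_ne_zero.2 (hζ.ne (by decide))
  funext ⟨s, t⟩
  cases s <;> simp only [Pi.add_apply, Pi.sub_apply, Pi.neg_apply, Pi.smul_apply, smul_eq_mul,
    vm3a, vm4a, vm0f, vm0t, vm1f, vm1t, vm2f, vm2t] <;> field_simp <;> ring

theorem rel_w2 (hζ : Function.Injective ζ) : vm F ζ 0 1 2 4 5 4 - vm F ζ 0 1 2 3 5 4
    = (ζ 4 - ζ 5)⁻¹ • (-(ζ 0 - ζ 4) • (vm F ζ 0 2 3 4 5 0 - vm F ζ 0 1 3 4 5 0)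
      + (ζ 1 - ζ 4) • (vm F ζ 1 2 3 4 5 0 + vm F ζ 0 1 3 4 5 1)
      + (ζ 2 - ζ 4) • (vm F ζ 1 2 3 4 5 1 - vm F ζ 0 2 3 4 5 1)
      + (ζ 3 - ζ 4) • (vm F ζ 1 2 3 4 5 2 - vm F ζ 0 2 3 4 5 2 + vm F ζ 0 1 3 4 5 2)) := by
  have h34 : ζ 3 - ζ 4 ≠ 0 := sub_ne_zero.2 (hζ.ne (by decide))
  have h35 : ζ 3 - ζ 5 ≠ 0 := sub_ne_zero.2 (hζ.ne (by decide))
  have h45 : ζ 4 - ζ 5 ≠ 0 := sub_ne_zero.2 (hζ.ne (by decide))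
  have h43 : ζ 4 - ζ 3 ≠ 0 := sub_ne_zero.2 (hζ.ne (by decide))
  have h53 : ζ 5 - ζ 3 ≠ 0 := sub_ne_zero.2 (hζ.ne (by decide))
  have h54 : ζ 5 - ζ 4 ≠ 0 := sub_ne_zero.2 (hζ.ne (by decide))
  funext ⟨s, t⟩
  cases s <;> simp only [Pi.add_apply, Pi.sub_apply, Pi.neg_apply, Pi.smul_apply, smul_eq_mul,
    vm3a, vm4a, vm0f, vm0t, vm1f, vm1t, vm2f, vm2t] <;> field_simp <;> ring

/-- Theorem 4 of the paper: the deformed 3→3 Pachner relation. If the x-chains of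
both sides come from the same boundary tetrahedron chain `c`, then the Berezin-integral
identity holds for the deformed weights `W̃` (with `ε₁₂₃₄₅ = 1`, `ε₁₂₃₄₆ = −1`,
`ε₁₂₃₅₆ = 1`, `ε₁₂₄₅₆ = 1`, `ε₁₃₄₅₆ = −1`, `ε₂₃₄₅₆ = 1`; vertices 0-indexed). -/
theorem pachner_33_deformed (hchar : (2 : F) ≠ 0) (hζ : Function.Injective ζ)
    (c : Finset (Fin 6) → F) :
    ((ζ 2 - ζ 3) * (ζ 2 - ζ 4) * (ζ 2 - ζ 5))⁻¹ •
      int2 F {0,1,2,5} (int2 F {0,1,2,4} (int2 F {0,1,2,3}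
        (Wt F ζ 1 0 1 2 3 4 (xch F c {{0,1,2,3},{0,1,2,4},{0,1,2,5}} 0 1 2 3 4) *
         Wt F ζ (-1) 0 1 2 3 5 (xch F c {{0,1,2,3},{0,1,2,4},{0,1,2,5}} 0 1 2 3 5) *
         Wt F ζ 1 0 1 2 4 5 (xch F c {{0,1,2,3},{0,1,2,4},{0,1,2,5}} 0 1 2 4 5) *
          (((ζ 1 - ζ 2)⁻¹ * (ζ 2 - ζ 3)) • av F {0,1,2,3}))))
    = ((ζ 4 - ζ 5) * (ζ 4 - ζ 5) * (ζ 4 - ζ 5))⁻¹ •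
        int2 F {2,3,4,5} (int2 F {1,3,4,5} (int2 F {0,3,4,5}
          (Wt F ζ 1 0 1 3 4 5 (xch F c {{0,3,4,5},{1,3,4,5},{2,3,4,5}} 0 1 3 4 5) *
           Wt F ζ (-1) 0 2 3 4 5 (xch F c {{0,3,4,5},{1,3,4,5},{2,3,4,5}} 0 2 3 4 5) *
           Wt F ζ 1 1 2 3 4 5 (xch F c {{0,3,4,5},{1,3,4,5},{2,3,4,5}} 1 2 3 4 5) *
            (-bv F {0,3,4,5})))) := by
  have h12 : ζ 1 - ζ 2 ≠ 0 := sub_ne_zero.2 (hζ.ne (by decide))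
  have h23 : ζ 2 - ζ 3 ≠ 0 := sub_ne_zero.2 (hζ.ne (by decide))
  have h24 : ζ 2 - ζ 4 ≠ 0 := sub_ne_zero.2 (hζ.ne (by decide))
  have h25 : ζ 2 - ζ 5 ≠ 0 := sub_ne_zero.2 (hζ.ne (by decide))
  have h34 : ζ 3 - ζ 4 ≠ 0 := sub_ne_zero.2 (hζ.ne (by decide))
  have h35 : ζ 3 - ζ 5 ≠ 0 := sub_ne_zero.2 (hζ.ne (by decide))
  have h45 : ζ 4 - ζ 5 ≠ 0 := sub_ne_zero.2 (hζ.ne (by decide))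
  have h43 : ζ 4 - ζ 3 ≠ 0 := sub_ne_zero.2 (hζ.ne (by decide))
  have h53 : ζ 5 - ζ 3 ≠ 0 := sub_ne_zero.2 (hζ.ne (by decide))
  have h54 : ζ 5 - ζ 4 ≠ 0 := sub_ne_zero.2 (hζ.ne (by decide))
  have hl : ((ζ 1 - ζ 2)⁻¹ * (ζ 2 - ζ 3)) • av F {0,1,2,3}
      = (-(ζ 1 - ζ 2)⁻¹) •
        ExteriorAlgebra.ι F ((-(ζ 2 - ζ 3)) • Pi.single (false, {0,1,2,3}) 1) := by
    rw [map_smul, av]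
    module
  have hr : -bv F {0,3,4,5} = (-(ζ 4 - ζ 5)⁻¹) •
        ExteriorAlgebra.ι F ((ζ 4 - ζ 5) • Pi.single (true, {0,3,4,5}) 1) := by
    rw [map_smul, bv, smul_smul, neg_mul, inv_mul_cancel₀ h45, neg_smul, one_smul]
  have int2_smul : ∀ (t : Finset (Fin 6)) (a : F) (x : Lam F),
      int2 F t (a • x) = a • int2 F t x := fun t a x => by simp [int2]
  rw [hl, hr, mul_smul_comm, mul_smul_comm]
  simp only [int2_smul]
  rw [lhs33 F ζ hζ c, rhs33 F ζ hζ c]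
  have key := fin33 F (vm F ζ 0 2 3 4 5 0 - vm F ζ 0 1 3 4 5 0)
    (vm F ζ 1 2 3 4 5 0 + vm F ζ 0 1 3 4 5 1) (vm F ζ 1 2 3 4 5 1 - vm F ζ 0 2 3 4 5 1)
    (vm F ζ 1 2 3 4 5 2 - vm F ζ 0 2 3 4 5 2 + vm F ζ 0 1 3 4 5 2)
    (ζ 0) (ζ 1) (ζ 2) (ζ 3) (ζ 4) (ζ 5) h12 h45
    (c {1,2,4,5}) (c {1,2,3,5}) (c {1,2,3,4}) (c {0,2,4,5}) (c {0,2,3,5}) (c {0,2,3,4})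
    (c {0,1,4,5}) (c {0,1,3,5}) (c {0,1,3,4})
    (vm F ζ 0 1 2 3 5 3 - vm F ζ 0 1 2 3 4 3) (vm F ζ 0 1 2 4 5 3 + vm F ζ 0 1 2 3 4 4)
    (vm F ζ 0 1 2 4 5 4 - vm F ζ 0 1 2 3 5 4)
    (vm F ζ 0 1 2 4 5 0 - vm F ζ 0 1 2 3 5 0 + vm F ζ 0 1 2 3 4 0) ?_ ?_ ?_ ?_
  · rw [smul_smul, smul_smul, smul_smul, smul_smul]
    refine Eq.trans (Eq.trans ?_ key) ?_
    · congr 1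
      field_simp
    · congr 1
      field_simp
  · exact rel_w0 F ζ hζ
  · exact rel_w1 F ζ hζ
  · exact rel_w2 F ζ hζ
  · exact rel_w3 F ζ

end
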